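/- arXiv:1611.01569 — 2 statements merged into one kernel-verified Lean document; each statement's English description precedes it below -/
import Mathlib

section
/- Invertibility equivalences for confluent-Vandermonde-triangular families: Let F be a field, λ_0,…,λ_{N−1} ∈ F with multiplicity counters n_i = #{k < i : λ_k = λ_i} and confluent Vandermonde matrix V, and let a_0,…,a_{N−1} ∈ F[X] have degree < N with coefficient matrix A. Assume ∏_{j<i}(X − λ_j) divides a_i(X) for every i (so that A·V^T is upper triangular). Then the following are equivalent: (a) A is invertible; (b) A·V^T is invertible; (c) (hasseDeriv_{n_i} a_i)(λ_i) ≠ 0 for every i; (d) for every i, ∏_{j≤i}(X − λ_j) does not divide a_i(X). -/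
open Polynomial Matrix

/-- The multiplicity counter `nᵢ = #{k < i : λ_k = λ_i}`. -/
def multCounter {F : Type*} [DecidableEq F] {N : ℕ} (lam : Fin N → F) (i : Fin N) : ℕ :=
  (Finset.univ.filter fun k : Fin N => k < i ∧ lam k = lam i).card

/-- The confluent Vandermonde matrix of `(λ₀, …, λ_{N−1})`:
`V[i,j] = C(j, nᵢ) · λᵢ^{j − nᵢ}` for `j ≥ nᵢ`, and `0` for `j < nᵢ`. -/
def confluentVandermonde {F : Type*} [Field F] [DecidableEq F] {N : ℕ} (lam : Fin N → F) :
    Matrix (Fin N) (Fin N) F :=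
  Matrix.of fun i j =>
    if multCounter lam i ≤ (j : ℕ) then
      (Nat.choose (j : ℕ) (multCounter lam i) : F) * lam i ^ ((j : ℕ) - multCounter lam i)
    else 0

/-- The coefficient matrix of a family of polynomials: `A[i,j]` is the coefficient of `X^j`
in `aᵢ`. -/
noncomputable def coeffMatrix {F : Type*} [Field F] {N : ℕ} (a : Fin N → Polynomial F) :
    Matrix (Fin N) (Fin N) F :=
  Matrix.of fun i j => (a i).coeff (j : ℕ)

theorem cv_entry {F : Type*} [Field F] [DecidableEq F] {N : ℕ} (lam : Fin N → F)
    (a : Fin N → Polynomial F) (hdeg : ∀ i, (a i).degree < (N : WithBot ℕ)) (i j : Fin N) :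
    (coeffMatrix a * (confluentVandermonde lam)ᵀ) i j
      = (Polynomial.hasseDeriv (multCounter lam j) (a i)).eval (lam j) := by
  rw [hasseDeriv_apply, Polynomial.sum_def, Polynomial.eval_finset_sum]
  rw [Finset.sum_subset (s₂ := Finset.range N)]
  · rw [← Fin.sum_univ_eq_sum_range
      (fun k => eval (lam j) (monomial (k - multCounter lam j)
        (((k.choose (multCounter lam j) : ℕ) : F) * (a i).coeff k))) N]
    simp only [Matrix.mul_apply, coeffMatrix, confluentVandermonde, Matrix.transpose_apply,
      Matrix.of_apply, eval_monomial]
    refine Finset.sum_congr rfl fun k _ => ?_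
    split_ifs with h
    · ring
    · rw [Nat.choose_eq_zero_of_lt (not_le.mp h)]; simp
  · intro k hk
    rw [Finset.mem_range]
    by_contra hN
    have : (a i).coeff k = 0 := coeff_eq_zero_of_degree_lt
      (lt_of_lt_of_le (hdeg i) (by exact_mod_cast not_lt.mp hN))
    exact (mem_support_iff.mp hk) this
  · intro k _ hk
    rw [notMem_support_iff.mp hk]; simp

theorem cv_hasse {F : Type*} [Field F] (l : F) (m k : ℕ) (q : Polynomial F) :
    (Polynomial.hasseDeriv k ((X - C l) ^ m * q)).eval l
      = if m ≤ k then (Polynomial.taylor l q).coeff (k - m) else 0 := by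
  rw [← taylor_coeff, taylor_mul, taylor_pow]
  have : taylor l (X - C l) = X := by simp
  rw [this, coeff_X_pow_mul']

theorem cv_split {F : Type*} [Field F] [DecidableEq F] {N : ℕ} (lam : Fin N → F) (i : Fin N) :
    ∃ R : Polynomial F, R.eval (lam i) ≠ 0 ∧
      (∏ j ∈ Finset.univ.filter fun j : Fin N => j < i, (X - Polynomial.C (lam j)))
        = (X - C (lam i)) ^ (multCounter lam i) * R := by
  refine ⟨∏ j ∈ (Finset.univ.filter fun j : Fin N => j < i).filter
    (fun j => ¬ lam j = lam i), (X - C (lam j)), ?_, ?_⟩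
  · rw [eval_prod, Finset.prod_ne_zero_iff]
    intro j hj
    have := (Finset.mem_filter.mp hj).2
    simpa [sub_eq_zero] using fun h => this (Eq.symm h)
  · rw [← Finset.prod_filter_mul_prod_filter_not _ (fun j => lam j = lam i)]
    congr 1
    rw [Finset.prod_congr rfl (g := fun _ => X - C (lam i))
      (fun j hj => by rw [(Finset.mem_filter.mp hj).2]),
      Finset.prod_const, Finset.filter_filter]
    rfl

theorem cv_le {F : Type*} [Field F] {N : ℕ} (lam : Fin N → F) (i : Fin N) :
    (∏ j ∈ Finset.univ.filter fun j : Fin N => j ≤ i, (X - Polynomial.C (lam j)))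
      = (∏ j ∈ Finset.univ.filter fun j : Fin N => j < i, (X - Polynomial.C (lam j)))
        * (X - C (lam i)) := by
  have : (Finset.univ.filter fun j : Fin N => j ≤ i)
      = insert i (Finset.univ.filter fun j : Fin N => j < i) := by
    ext j; simp [le_iff_eq_or_lt]
  rw [this, Finset.prod_insert (by simp), mul_comm]

theorem cv_c_iff_d {F : Type*} [Field F] [DecidableEq F] {N : ℕ} (lam : Fin N → F) (i : Fin N)
    (p : Polynomial F)
    (h : (∏ j ∈ Finset.univ.filter fun j : Fin N => j < i, (X - Polynomial.C (lam j))) ∣ p) :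
    (Polynomial.hasseDeriv (multCounter lam i) p).eval (lam i) = 0 ↔
      (∏ j ∈ Finset.univ.filter fun j : Fin N => j ≤ i, (X - Polynomial.C (lam j))) ∣ p := by
  obtain ⟨b, rfl⟩ := h
  have h0 : (∏ j ∈ Finset.univ.filter fun j : Fin N => j < i,
      (X - Polynomial.C (lam j))) ≠ 0 :=
    Finset.prod_ne_zero_iff.mpr fun j _ => X_sub_C_ne_zero _
  rw [cv_le, mul_dvd_mul_iff_left h0, dvd_iff_isRoot]
  obtain ⟨R, hR, hP⟩ := cv_split lam i
  rw [hP, mul_assoc, cv_hasse, if_pos le_rfl, Nat.sub_self, taylor_coeff_zero, eval_mul]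
  simp [hR]

theorem cv_b_iff_c {F : Type*} [Field F] [DecidableEq F] {N : ℕ} (lam : Fin N → F)
    (a : Fin N → Polynomial F) (hdeg : ∀ i, (a i).degree < (N : WithBot ℕ))
    (hdvd : ∀ i : Fin N,
      (∏ j ∈ Finset.univ.filter fun j : Fin N => j < i,
        (X - Polynomial.C (lam j))) ∣ a i) :
    IsUnit (coeffMatrix a * (confluentVandermonde lam)ᵀ) ↔
      ∀ i : Fin N, (Polynomial.hasseDeriv (multCounter lam i) (a i)).eval (lam i) ≠ 0 := by
  have htri : (coeffMatrix a * (confluentVandermonde lam)ᵀ).BlockTriangular id := by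
    intro i j hij
    have hij : j < i := hij
    rw [cv_entry lam a hdeg]
    have hd : (∏ k ∈ Finset.univ.filter fun k : Fin N => k ≤ j, (X - C (lam k))) ∣ a i := by
      refine dvd_trans (Finset.prod_dvd_prod_of_subset _ _ _ ?_) (hdvd i)
      intro k hk
      simp only [Finset.mem_filter, Finset.mem_univ, true_and] at hk ⊢
      exact lt_of_le_of_lt hk hij
    exact (cv_c_iff_d lam j (a i) (dvd_trans ⟨_, cv_le lam j⟩ hd)).mpr hd
  rw [Matrix.isUnit_iff_isUnit_det, Matrix.det_of_upperTriangular htri, isUnit_iff_ne_zero,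
    Finset.prod_ne_zero_iff]
  simp only [cv_entry lam a hdeg, Finset.mem_univ, true_imp_iff]

theorem cv_isUnit {F : Type*} [Field F] [DecidableEq F] {N : ℕ} (lam : Fin N → F) :
    IsUnit (confluentVandermonde lam)ᵀ.det := by
  have h := (cv_b_iff_c lam
    (fun i => ∏ j ∈ Finset.univ.filter fun j : Fin N => j < i, (X - C (lam j))) ?_
    (fun i => dvd_rfl)).mpr ?_
  · rw [Matrix.isUnit_iff_isUnit_det, Matrix.det_mul] at h
    exact isUnit_of_mul_isUnit_right h
  · intro i
    rw [degree_prod]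
    simp only [degree_X_sub_C, Finset.sum_const, nsmul_eq_mul, mul_one]
    have : (Finset.univ.filter fun j : Fin N => j < i).card < N := by
      have := Finset.card_lt_univ_of_notMem (s := Finset.univ.filter fun j : Fin N => j < i)
        (x := i) (by simp)
      simpa using this
    exact_mod_cast this
  · intro i
    obtain ⟨R, hR, hP⟩ := cv_split lam i
    simp only [hP]
    rw [cv_hasse, if_pos le_rfl, Nat.sub_self, taylor_coeff_zero]
    exact hR

/-- **Invertibility equivalences for confluent-Vandermonde-triangular families.** Assuming
`∏_{j<i}(X − λⱼ) ∣ aᵢ` for all `i`, the following are equivalent: `A` invertible; `A·Vᵀ`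
invertible; the diagonal Hasse evaluations `(hasseDeriv_{nᵢ} aᵢ)(λᵢ)` are all nonzero; for
every `i`, `∏_{j≤i}(X − λⱼ)` does not divide `aᵢ`. -/
theorem confluent_vandermonde_invertibility
    (F : Type*) [Field F] [DecidableEq F] (N : ℕ)
    (lam : Fin N → F)
    (a : Fin N → Polynomial F) (hdeg : ∀ i, (a i).degree < (N : WithBot ℕ))
    (hdvd : ∀ i : Fin N,
      (∏ j ∈ Finset.univ.filter fun j : Fin N => j < i,
        (X - Polynomial.C (lam j))) ∣ a i) :
    List.TFAE [
      IsUnit (coeffMatrix a),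
      IsUnit (coeffMatrix a * (confluentVandermonde lam)ᵀ),
      ∀ i : Fin N, (Polynomial.hasseDeriv (multCounter lam i) (a i)).eval (lam i) ≠ 0,
      ∀ i : Fin N,
        ¬ ((∏ j ∈ Finset.univ.filter fun j : Fin N => j ≤ i,
          (X - Polynomial.C (lam j))) ∣ a i)] := by
  tfae_have 1 ↔ 2 := by
    rw [Matrix.isUnit_iff_isUnit_det, Matrix.isUnit_iff_isUnit_det, Matrix.det_mul,
      IsUnit.mul_iff]
    exact ⟨fun h => ⟨h, cv_isUnit lam⟩, fun h => h.1⟩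
  tfae_have 2 ↔ 3 := cv_b_iff_c lam a hdeg hdvd
  tfae_have 3 ↔ 4 := forall_congr' fun i => not_congr (cv_c_iff_d lam i (a i) (hdvd i))
  tfae_finish
end

section
/- Stein displacement with a banded triangular operator yields a matrix recurrence on rows: Let F be a field, t ≥ 0, and let L, R, A, E be N×N matrices over F with L lower triangular and (t+1)-band (L[i,j] = 0 unless i−t ≤ j ≤ i). Then A − L·A·R = E if and only if for every 0 ≤ i < N, rowᵢ(A)·(I − L[i,i]·R) = Σ_{j=1}^{min(i,t)} L[i,i−j]·row_{i−j}(A)·R + rowᵢ(E), where rowᵢ(·) denotes the i-th row of a matrix, regarded as a row vector multiplying the matrix on its right. (Thus, when E has rank r, the rows of A satisfy an R-matrix recurrence of width (t, r) and degree (1,1).) -/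
open Matrix

theorem band_sum_aux
    (F : Type*) [Field F] (N t : ℕ) (L : Matrix (Fin N) (Fin N) F)
    (hL : ∀ i j : Fin N, ((j : ℕ) + t < (i : ℕ) ∨ (i : ℕ) < (j : ℕ)) → L i j = 0)
    (g : Fin N → Fin N → F) (i : Fin N) :
    ∑ k, L i k • g k = L i i • g i + ∑ j ∈ Finset.Icc 1 (min (i : ℕ) t),
              L i ⟨(i : ℕ) - j, lt_of_le_of_lt (Nat.sub_le _ _) i.isLt⟩ •
                g ⟨(i : ℕ) - j, lt_of_le_of_lt (Nat.sub_le _ _) i.isLt⟩ := by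
  rw [← Finset.add_sum_erase _ _ (Finset.mem_univ i)]
  congr 1
  symm
  apply Finset.sum_of_injOn
    (fun j : ℕ => (⟨(i : ℕ) - j, lt_of_le_of_lt (Nat.sub_le _ _) i.isLt⟩ : Fin N))
  · intro a ha b hb hab
    simp only [Finset.coe_Icc, Set.mem_Icc, Fin.mk.injEq] at ha hb hab
    omega
  · intro a ha
    simp only [Finset.coe_Icc, Set.mem_Icc] at ha
    simp only [Finset.mem_coe, Finset.mem_erase, Finset.mem_univ, and_true, ne_eq, Fin.ext_iff]
    omega
  · intro k hk hk2
    have hne : (k : ℕ) ≠ i := fun h => (Finset.mem_erase.1 hk).1 (Fin.ext h)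
    rw [hL i k, zero_smul]
    by_contra hc
    apply hk2
    refine ⟨(i : ℕ) - k, ?_, ?_⟩
    · simp only [Finset.coe_Icc, Set.mem_Icc]
      omega
    · apply Fin.ext
      simp only
      omega
  · intro j hj
    rfl

/-- **Stein displacement with a banded triangular operator yields a matrix recurrence on
rows.** For `L` lower triangular and `(t+1)`-band, `A − L·A·R = E` iff every row of `A`
satisfies
`rowᵢ(A)·(I − L[i,i]·R) = ∑_{j=1}^{min(i,t)} L[i,i−j]·row_{i−j}(A)·R + rowᵢ(E)`. -/
theorem stein_displacement_recurrence
    (F : Type*) [Field F] (N t : ℕ)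
    (L R A E : Matrix (Fin N) (Fin N) F)
    (hL : ∀ i j : Fin N, ((j : ℕ) + t < (i : ℕ) ∨ (i : ℕ) < (j : ℕ)) → L i j = 0) :
    A - L * A * R = E ↔
      ∀ i : Fin N,
        Matrix.vecMul (A i) ((1 : Matrix (Fin N) (Fin N) F) - L i i • R) =
          (∑ j ∈ Finset.Icc 1 (min (i : ℕ) t),
              L i ⟨(i : ℕ) - j, lt_of_le_of_lt (Nat.sub_le _ _) i.isLt⟩ •
                Matrix.vecMul (A ⟨(i : ℕ) - j, lt_of_le_of_lt (Nat.sub_le _ _) i.isLt⟩) R)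
            + E i := by
  have hrow : ∀ i, (A - L * A * R) i = A i - ∑ k, L i k • Matrix.vecMul (A k) R := by
    intro i
    have h1 : (L * A * R) i = Matrix.vecMul (L i) (A * R) := by
      rw [Matrix.mul_assoc]; rfl
    have h2 : Matrix.vecMul (L i) (A * R) = ∑ k, L i k • Matrix.vecMul (A k) R := by
      rw [Matrix.vecMul_eq_sum]; rfl
    rw [← h2, ← h1]; rfl
  have key : ∀ i, (A - L * A * R) i = E i ↔ _ := fun i => by
    rw [hrow i, band_sum_aux F N t L hL (fun k => Matrix.vecMul (A k) R) i]
  refine (show A - L * A * R = E ↔ ∀ i, (A - L * A * R) i = E i from funext_iff).trans ?_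
  refine forall_congr' fun i => (key i).trans ?_
  rw [Matrix.vecMul_sub, Matrix.vecMul_one, Matrix.vecMul_smul, sub_eq_iff_eq_add,
    sub_eq_iff_eq_add]
  constructor
  · intro h; refine h.trans ?_; abel
  · intro h; refine h.trans ?_; abel
end
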